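/- Let φ ∈ 𝓜 be continuous, let 0 ≤ q ∈ ℤ, and suppose ∫₁^∞ dt/(t φ²(t)) = ∞. Then there exists a function w ∈ H^{q+n/2,φ}(ℝⁿ) with compact support contained in a given open nonempty set G ⊂ ℝⁿ such that w ∉ C^q(ℝⁿ). Equivalently, the inclusion {w ∈ H^{q+n/2,φ}(ℝⁿ) : supp w ⊂ G} ⊂ C^q(ℝⁿ) fails. -/

import Mathlib

open Filter MeasureTheory ENNReal
open scoped FourierTransform SchwartzMap

/-- The class `𝓜`. -/
def MClass (φ : ℝ → ℝ) : Prop :=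
  Measurable φ ∧ (∀ t, 1 ≤ t → 0 < φ t) ∧
  (∀ b : ℝ, 1 < b → ∃ C > 0, ∀ t ∈ Set.Icc (1:ℝ) b, φ t ≤ C ∧ C⁻¹ ≤ φ t) ∧
  (∀ l : ℝ, 0 < l → Tendsto (fun t => φ (l * t) / φ t) atTop (nhds 1))

/-- The Hörmander weight `⟨ξ⟩^{2s} φ(⟨ξ⟩)²`. -/
noncomputable def hWeight {n : ℕ} (s : ℝ) (φ : ℝ → ℝ) (ξ : EuclideanSpace ℝ (Fin n)) : ℝ :=
  (1 + ‖ξ‖ ^ 2) ^ s * (φ (Real.sqrt (1 + ‖ξ‖ ^ 2))) ^ 2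

/-- The square of the `H^{s,φ}` norm of a distribution with Fourier transform `W`. -/
noncomputable def hInt (n : ℕ) (s : ℝ) (φ : ℝ → ℝ) (W : EuclideanSpace ℝ (Fin n) → ℂ) :
    ℝ≥0∞ :=
  ∫⁻ ξ, ENNReal.ofReal (hWeight s φ ξ * ‖W ξ‖ ^ 2)

open scoped LineDeriv

/-- A continuous function whose translates are asymptotically equal at infinity is Lipschitz at
large scales. -/
theorem exists_abs_sub_le_of_tendsto_translate {h : ℝ → ℝ} (hc : Continuous h)
    (ht : ∀ u : ℝ, Tendsto (fun x => h (x + u) - h x) atTop (nhds 0)) :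
    ∃ (A : ℝ) (N : ℕ), ∀ x y, 0 ≤ x → 0 ≤ y → |h x - h y| ≤ A + N * |x - y| := by
  let E : ℕ → Set ℝ := fun m => {u | ∀ x : ℝ, (m : ℝ) ≤ x → |h (x + u) - h x| ≤ 1}
  have hE : ∀ m, IsClosed (E m) := by
    intro m
    have : E m = ⋂ (x : ℝ) (_ : (m : ℝ) ≤ x), {u | |h (x + u) - h x| ≤ 1} := by
      ext u; simp [E]
    rw [this]
    refine isClosed_iInter fun x => isClosed_iInter fun _ => ?_
    exact isClosed_le (by fun_prop) continuous_const
  have hU : ⋃ m, E m = Set.univ := by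
    refine Set.eq_univ_of_forall fun u => ?_
    have h1 := (ht u).eventually (Metric.closedBall_mem_nhds 0 one_pos)
    obtain ⟨X, hX⟩ := eventually_atTop.1 h1
    obtain ⟨m, hm⟩ := exists_nat_ge X
    refine Set.mem_iUnion.2 ⟨m, fun x hx => ?_⟩
    simpa using hX x (hm.trans hx)
  obtain ⟨m, a, ha⟩ := nonempty_interior_of_iUnion_of_closed hE hU
  obtain ⟨δ, hδ, hball⟩ := Metric.isOpen_iff.1 isOpen_interior a ha
  have hstep : ∀ x v : ℝ, (m : ℝ) + a ≤ x → |v| < δ → |h (x + v) - h x| ≤ 2 := by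
    intro x v hx hv
    have h1 : a + v ∈ E m := interior_subset (hball (by simpa using hv))
    have h2 : a ∈ E m := interior_subset ha
    have h3 := h1 (x - a) (by linarith)
    have h4 := h2 (x - a) (by linarith)
    rw [show x - a + (a + v) = x + v by ring] at h3
    rw [show x - a + a = x by ring] at h4
    rw [abs_le] at *
    constructor <;> linarith
  set M : ℝ := max (m + a) 0
  set d : ℝ := δ / 2
  have hd : 0 < d := by positivity
  have hdδ : d < δ := half_lt_self hδ
  have hiter : ∀ k : ℕ, ∀ x v : ℝ, M ≤ x → 0 ≤ v → v ≤ k * d → |h (x + v) - h x| ≤ 2 * k := by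
    intro k
    induction k with
    | zero =>
      intro x v _ h0 h1
      have : v = 0 := le_antisymm (by simpa using h1) h0
      simp [this]
    | succ k ih =>
      intro x v hx h0 h1
      push_cast at h1 ⊢
      by_cases hv : v ≤ d
      · have := hstep x v ((le_max_left _ _).trans hx) (by rw [abs_of_nonneg h0]; linarith)
        have hk : (0 : ℝ) ≤ k := k.cast_nonneg
        linarith
      · push Not at hv
        have h2 := ih x (v - d) hx (by linarith) (by linarith)
        have h3 := hstep (x + (v - d)) d ((le_max_left _ _).trans (by linarith))
          (by rw [abs_of_pos hd]; linarith)
        rw [show x + (v - d) + d = x + v by ring] at h3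
        rw [abs_le] at *
        constructor <;> linarith
  obtain ⟨N, hN⟩ := exists_nat_ge (2 / d)
  have hlarge' : ∀ x y : ℝ, M ≤ x → x ≤ y → |h y - h x| ≤ 2 + N * (y - x) := by
    intro x y hx hxy
    have h1 := hiter ⌈(y - x) / d⌉₊ x (y - x) hx (by linarith)
      ((div_le_iff₀ hd).1 (Nat.le_ceil _))
    rw [add_sub_cancel] at h1
    have h2 := Nat.ceil_lt_add_one (a := (y - x) / d) (div_nonneg (by linarith) hd.le)
    have h3 : 2 * ((y - x) / d) ≤ N * (y - x) := by
      rw [show 2 * ((y - x) / d) = 2 / d * (y - x) by ring]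
      exact mul_le_mul_of_nonneg_right hN (by linarith)
    linarith
  have hlarge : ∀ x y : ℝ, M ≤ x → M ≤ y → |h x - h y| ≤ 2 + N * |x - y| := by
    intro x y hx hy
    rcases le_total x y with hxy | hxy
    · rw [abs_sub_comm (h x), abs_sub_comm x, abs_of_nonneg (sub_nonneg.2 hxy)]
      exact hlarge' x y hx hxy
    · rw [abs_of_nonneg (sub_nonneg.2 hxy)]
      exact hlarge' y x hy hxy
  obtain ⟨B, hB⟩ := (isCompact_Icc (a := (0 : ℝ)) (b := M)).exists_bound_of_continuousOn
    hc.continuousOn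
  have hsmall : ∀ x : ℝ, 0 ≤ x → |h x - h (max x M)| ≤ 2 * B := by
    intro x hx
    have hB0 : 0 ≤ B := (norm_nonneg _).trans (hB 0 ⟨le_rfl, le_max_right _ _⟩)
    rcases le_total x M with hxM | hxM
    · rw [max_eq_right hxM]
      have h1 := hB x ⟨hx, hxM⟩
      have h2 := hB M ⟨le_max_right _ _, le_rfl⟩
      rw [Real.norm_eq_abs, abs_le] at h1 h2
      rw [abs_le]
      constructor <;> linarith
    · rw [max_eq_left hxM]
      simpa using hB0
  refine ⟨4 * B + 2, N, fun x y hx hy => ?_⟩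
  have h1 := hsmall x hx
  have h2 := hsmall y hy
  have h3 := hlarge (max x M) (max y M) (le_max_right _ _) (le_max_right _ _)
  have h4 : (N : ℝ) * |max x M - max y M| ≤ N * |x - y| :=
    mul_le_mul_of_nonneg_left (by simpa using abs_max_sub_max_le_abs x y M) N.cast_nonneg
  rw [abs_le] at h1 h2 h3 ⊢
  constructor <;> linarith

/-- Potter's bound for continuous slowly varying functions, with a non-optimal exponent. -/
theorem exists_le_mul_max_pow_mul {φ : ℝ → ℝ} (hpos : ∀ t, 1 ≤ t → 0 < φ t)
    (hslow : ∀ l : ℝ, 0 < l → Tendsto (fun t => φ (l * t) / φ t) atTop (nhds 1))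
    (hcont : ContinuousOn φ (Set.Ici (1 : ℝ))) :
    ∃ C > 0, ∃ N : ℕ, ∀ s t, 1 ≤ s → 1 ≤ t → φ t ≤ C * (max (t / s) (s / t)) ^ N * φ s := by
  have h1 : ∀ x : ℝ, 1 ≤ Real.exp (max x 0) := fun x => Real.one_le_exp (le_max_right _ _)
  obtain ⟨A, N, hAN⟩ := exists_abs_sub_le_of_tendsto_translate
    (h := fun x => Real.log (φ (Real.exp (max x 0))))
    (by
      refine Continuous.log ?_ fun x => (hpos _ (h1 x)).ne'
      exact hcont.comp_continuous (by fun_prop) h1)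
    (by
      intro u
      have h2 := ((hslow (Real.exp u) (Real.exp_pos u)).comp Real.tendsto_exp_atTop).log one_ne_zero
      rw [Real.log_one] at h2
      refine h2.congr' ?_
      filter_upwards [eventually_ge_atTop 0, eventually_ge_atTop (-u)] with x hx hxu
      have hxu' : 0 ≤ x + u := by linarith
      simp only [Function.comp_apply]
      rw [max_eq_left hx, max_eq_left hxu', ← Real.exp_add, add_comm u x, Real.log_div]
      · exact (hpos _ (Real.one_le_exp hxu')).ne'
      · exact (hpos _ (Real.one_le_exp hx)).ne')
  refine ⟨Real.exp A, Real.exp_pos A, N, fun s t hs ht => ?_⟩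
  have hs0 : 0 < s := by linarith
  have ht0 : 0 < t := by linarith
  have h3 := (le_abs_self _).trans (hAN (Real.log t) (Real.log s) (Real.log_nonneg ht)
    (Real.log_nonneg hs))
  simp only [max_eq_left (Real.log_nonneg ht), max_eq_left (Real.log_nonneg hs),
    Real.exp_log ht0, Real.exp_log hs0] at h3
  have h4 : Real.exp |Real.log t - Real.log s| = max (t / s) (s / t) := by
    rw [abs_eq_max_neg, Real.exp_monotone.map_max, neg_sub, ← Real.log_div ht0.ne' hs0.ne',
      ← Real.log_div hs0.ne' ht0.ne', Real.exp_log (by positivity), Real.exp_log (by positivity)]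
  rw [← h4, ← Real.exp_nat_mul, ← Real.exp_add, ← Real.exp_log (hpos s hs), ← Real.exp_add,
    ← Real.log_le_iff_le_exp (hpos t ht)]
  linarith

theorem not_summable_inv_sq_of_lintegral_eq_top {φ : ℝ → ℝ} {C : ℝ} {N : ℕ} (hC : 0 < C)
    (hpos : ∀ t, 1 ≤ t → 0 < φ t)
    (hφ : ∀ s t, 1 ≤ s → 1 ≤ t → φ t ≤ C * (max (t / s) (s / t)) ^ N * φ s)
    (hdiv : (∫⁻ t in Set.Ioi (1 : ℝ), ENNReal.ofReal (1 / (t * (φ t) ^ 2))) = ⊤) :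
    ¬ Summable fun k : ℕ => (φ (2 ^ k) ^ 2)⁻¹ := by
  intro hs
  have h1 : ∀ k : ℕ, (1 : ℝ) ≤ 2 ^ k := fun k => one_le_pow₀ one_le_two
  set D : ℝ := (C * 2 ^ N) ^ 2
  have hD : 0 < D := by positivity
  have hsub : Set.Ioi (1 : ℝ) ⊆ ⋃ k : ℕ, Set.Ico ((2 : ℝ) ^ k) (2 ^ (k + 1)) := by
    intro t ht
    obtain ⟨k, hk⟩ := exists_nat_pow_near (Set.mem_Ioi.1 ht).le _root_.one_lt_two
    exact Set.mem_iUnion.2 ⟨k, hk⟩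
  have hpiece : ∀ k : ℕ, ∫⁻ t in Set.Ico ((2 : ℝ) ^ k) (2 ^ (k + 1)),
      ENNReal.ofReal (1 / (t * (φ t) ^ 2)) ≤ ENNReal.ofReal (D * (φ (2 ^ k) ^ 2)⁻¹) := by
    intro k
    have hk := hpos _ (h1 k)
    calc _ ≤ ∫⁻ t in Set.Ico ((2 : ℝ) ^ k) (2 ^ (k + 1)),
          ENNReal.ofReal ((2 ^ k)⁻¹ * (D * (φ (2 ^ k) ^ 2)⁻¹)) := by
          refine setLIntegral_mono measurable_const fun t ht => ENNReal.ofReal_le_ofReal ?_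
          have h0 : (0 : ℝ) < 2 ^ k := by positivity
          have ht0 : 0 < t := h0.trans_le ht.1
          have ht1 : 1 ≤ t := (h1 k).trans ht.1
          have h2 := hφ t (2 ^ k) ht1 (h1 k)
          have h3 : max (2 ^ k / t) (t / 2 ^ k) ≤ 2 := by
            refine max_le ?_ ?_
            · rw [div_le_iff₀ ht0]; linarith [ht.1]
            · rw [div_le_iff₀ h0]; have := ht.2.le; rw [pow_succ] at this; linarith
          have h4 : φ (2 ^ k) ≤ C * 2 ^ N * φ t := by
            refine h2.trans ?_
            have := hpos t ht1
            gcongr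
          have h5 := hpos t ht1
          have h6 : φ (2 ^ k) ^ 2 ≤ D * φ t ^ 2 := by
            rw [← mul_pow]; gcongr
          rw [one_div, mul_inv]
          have h7 : (φ t ^ 2)⁻¹ ≤ D * (φ (2 ^ k) ^ 2)⁻¹ := by
            rw [← div_eq_mul_inv, inv_eq_one_div, div_le_div_iff₀ (by positivity) (by positivity)]
            linarith
          have h8 : t⁻¹ ≤ (2 ^ k)⁻¹ := inv_anti₀ h0 ht.1
          gcongr
      _ = _ := by
          rw [setLIntegral_const, Real.volume_Ico, ← ENNReal.ofReal_mul (by positivity)]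
          congr 1
          rw [pow_succ]
          field_simp
          ring
  have := calc
    (⊤ : ℝ≥0∞) = _ := hdiv.symm
    _ ≤ ∫⁻ t in ⋃ k : ℕ, Set.Ico ((2 : ℝ) ^ k) (2 ^ (k + 1)),
          ENNReal.ofReal (1 / (t * (φ t) ^ 2)) := lintegral_mono_set hsub
    _ ≤ ∑' k : ℕ, ∫⁻ t in Set.Ico ((2 : ℝ) ^ k) (2 ^ (k + 1)),
          ENNReal.ofReal (1 / (t * (φ t) ^ 2)) := lintegral_iUnion_le _ _
    _ ≤ ∑' k : ℕ, ENNReal.ofReal (D * (φ (2 ^ k) ^ 2)⁻¹) := ENNReal.tsum_le_tsum hpiece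
    _ < ⊤ := by
        rw [← ENNReal.ofReal_tsum_of_nonneg (fun k => by positivity) (hs.mul_left D)]
        exact ENNReal.ofReal_lt_top
  exact lt_irrefl _ this

/-- A variant of the Abel–Dini theorem. -/
theorem exists_not_summable_summable_sq_div {c : ℕ → ℝ} (hc : ∀ k, 0 < c k)
    (hs : ¬ Summable c) :
    ∃ a : ℕ → ℝ, (∀ k, 0 ≤ a k) ∧ ¬ Summable a ∧ Summable fun k => a k ^ 2 / c k := by
  set S : ℕ → ℝ := fun k => ∑ i ∈ Finset.range (k + 1), c i
  have hS : ∀ k, 0 < S k := fun k => Finset.sum_pos (fun i _ => hc i) (by simp)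
  have hSs : ∀ k, S (k + 1) = S k + c (k + 1) := fun k => Finset.sum_range_succ _ _
  have hmono : Monotone S := monotone_nat_of_le_succ fun k => by rw [hSs]; linarith [hc (k + 1)]
  have htop : Tendsto S atTop atTop :=
    ((not_summable_iff_tendsto_nat_atTop_of_nonneg fun k => (hc k).le).1 hs).comp
      (tendsto_add_atTop_nat 1)
  refine ⟨fun k => c k / S k, fun k => (div_pos (hc k) (hS k)).le, fun ha => ?_, ?_⟩
  · have h1 := (ha.hasSum.tendsto_sum_nat.comp (tendsto_add_atTop_nat 1)).cauchySeq
    obtain ⟨m, hm⟩ := Metric.cauchySeq_iff'.1 h1 (1 / 2) (by norm_num)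
    have key : ∀ j, (S (m + j) - S m) / S (m + j) ≤
        ∑ i ∈ Finset.range (m + j + 1), c i / S i - ∑ i ∈ Finset.range (m + 1), c i / S i := by
      intro j
      induction j with
      | zero => simp
      | succ j ih =>
        rw [← add_assoc, Finset.sum_range_succ, hSs]
        have h2 := hS (m + j)
        have h3 := hc (m + j + 1)
        have h4 : (S (m + j) + c (m + j + 1) - S m) / (S (m + j) + c (m + j + 1)) ≤
            (S (m + j) - S m) / S (m + j) + c (m + j + 1) / (S (m + j) + c (m + j + 1)) := by
          have h5 : 0 ≤ S (m + j) - S m := sub_nonneg.2 (hmono (by omega))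
          have h6 : (S (m + j) - S m) / (S (m + j) + c (m + j + 1)) ≤
            (S (m + j) - S m) / S (m + j) := by gcongr; linarith
          rw [add_sub_right_comm, add_div]
          linarith
        linarith
    obtain ⟨j, hj⟩ := (htop.eventually_ge_atTop (4 * S m)).exists_forall_of_atTop
    have h7 := hj (m + j) (by omega)
    have h8 := key j
    have h9 := hm (m + j) (by omega)
    simp only [Function.comp_apply] at h9
    rw [Real.dist_eq, abs_lt] at h9
    have h10 : 3 / 4 ≤ (S (m + j) - S m) / S (m + j) := by
      rw [le_div_iff₀ (hS _)]; linarith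
    linarith
  · have h1 : ∀ k, (c k / S k) ^ 2 / c k = c k / S k ^ 2 := by
      intro k; have := hc k; have := hS k; field_simp
    simp only [h1]
    refine summable_of_sum_range_le (c := 2 / S 0) (fun k => by have := hc k; positivity) ?_
    suffices h : ∀ n, ∑ i ∈ Finset.range (n + 1), c i / S i ^ 2 ≤ 2 / S 0 - 1 / S n by
      intro n
      have h2 := h n
      rw [Finset.sum_range_succ] at h2
      have := hc n
      have h3 : 0 ≤ c n / S n ^ 2 := by positivity
      have h4 : 0 < 1 / S n := by have := hS n; positivity
      linarith
    intro n
    induction n with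
    | zero =>
      have h2 : S 0 = c 0 := by simp [S]
      have := hc 0
      rw [Finset.sum_range_one, h2]
      apply le_of_eq; field_simp; norm_num
    | succ n ih =>
      rw [Finset.sum_range_succ]
      have h2 := hS n
      have h3 := hc (n + 1)
      have h4 : c (n + 1) / S (n + 1) ^ 2 ≤ 1 / S n - 1 / S (n + 1) := by
        rw [hSs, div_sub_div _ _ (by positivity) (by positivity),
          div_le_div_iff₀ (by positivity) (by positivity)]
        nlinarith [mul_pos h2 h3, mul_pos h3 h3, mul_pos (mul_pos h3 h3) h2,
          mul_pos (mul_pos h3 h3) h3, mul_pos (mul_pos h3 h2) h2]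
      linarith

/-- There are test functions with small support and nonnegative Fourier transform. -/
theorem exists_schwartzMap_fourier_nonneg (V : Type*) [NormedAddCommGroup V]
    [InnerProductSpace ℝ V] [FiniteDimensional ℝ V] [MeasurableSpace V] [BorelSpace V]
    {ρ : ℝ} (hρ : 0 < ρ) :
    ∃ (θ : 𝓢(V, ℂ)) (p : V → ℝ), Continuous p ∧ (∀ ξ, 0 ≤ p ξ) ∧ 0 < p 0 ∧
      (∀ ξ, 𝓕 (θ : V → ℂ) ξ = p ξ) ∧ tsupport θ ⊆ Metric.closedBall 0 ρ := by
  let b : ContDiffBump (0 : V) := ⟨ρ / 4, ρ / 2, by positivity, by linarith⟩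
  let χ : V → ℂ := fun x => (b x : ℂ)
  have hχs : ContDiff ℝ (⊤ : ℕ∞) χ := Complex.ofRealCLM.contDiff.comp (b.contDiff (n := ⊤))
  have hχc : HasCompactSupport χ := b.hasCompactSupport.comp_left Complex.ofReal_zero
  have hχi : Integrable χ := hχs.continuous.integrable_of_hasCompactSupport hχc
  have hreal : ∀ ξ, (starRingEnd ℂ) (𝓕 χ ξ) = 𝓕 χ ξ := by
    intro ξ
    rw [Real.fourier_eq, ← integral_conj, ← integral_neg_eq_self]
    congr 1
    ext x
    simp [χ, Circle.smul_def, AddChar.map_neg_eq_inv, b.neg]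
  let θ₀ : V → ℂ := convolution χ χ (ContinuousLinearMap.mul ℂ ℂ) volume
  have hθc : HasCompactSupport θ₀ := hχc.convolution _ hχc
  have hθs : ContDiff ℝ (⊤ : ℕ∞) θ₀ := by
    change ContDiff ℝ (⊤ : ℕ∞) (convolution χ χ (ContinuousLinearMap.mul ℝ ℂ) volume)
    exact hχc.contDiff_convolution_left _ hχs hχi.locallyIntegrable
  have hF : ∀ ξ, 𝓕 θ₀ ξ = (Complex.normSq (𝓕 χ ξ) : ℂ) := by
    intro ξ
    rw [Real.fourier_mul_convolution_eq hχi hχi, Complex.normSq_eq_conj_mul_self, hreal]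
  refine ⟨hθc.toSchwartzMap hθs, fun ξ => Complex.normSq (𝓕 χ ξ), ?_,
    fun ξ => Complex.normSq_nonneg _, ?_, hF, ?_⟩
  · exact Complex.continuous_normSq.comp
      (VectorFourier.fourierIntegral_continuous Real.continuous_fourierChar continuous_inner hχi)
  · rw [Complex.normSq_pos, Real.fourier_eq]
    have : (∫ v, (b v : ℂ)) ≠ 0 := by
      rw [integral_complex_ofReal]
      exact_mod_cast b.integral_pos.ne'
    simpa [χ] using this
  · refine closure_minimal ?_ Metric.isClosed_closedBall
    refine (support_convolution_subset (ContinuousLinearMap.mul ℂ ℂ)).trans ?_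
    have : Function.support χ ⊆ Metric.ball 0 (ρ / 2) := by
      intro x hx
      have hb : x ∈ Function.support b := by simpa [χ] using hx
      rwa [b.support_eq] at hb
    rintro x ⟨y, hy, z, hz, rfl⟩
    have h1 := this hy
    have h2 := this hz
    simp only [mem_ball_zero_iff] at h1 h2
    simp only [mem_closedBall_zero_iff]
    linarith [norm_add_le y z]

theorem SchwartzMap.exists_comp_smul_sub {V : Type*} [NormedAddCommGroup V]
    [InnerProductSpace ℝ V] [FiniteDimensional ℝ V] [MeasurableSpace V] [BorelSpace V]
    (f : 𝓢(V, ℂ)) {c : ℝ} (hc : 0 < c) (x₀ : V) :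
    ∃ g : 𝓢(V, ℂ), (∀ x, g x = f (c • (x - x₀))) ∧
      ∀ ξ, 𝓕 (g : V → ℂ) ξ = (c ^ Module.finrank ℝ V)⁻¹ • ((𝐞 (-inner ℝ x₀ ξ)) •
        𝓕 (f : V → ℂ) (c⁻¹ • ξ)) := by
  let L : V ≃L[ℝ] V := ContinuousLinearEquiv.smulLeft (Units.mk0 c hc.ne')
  refine ⟨SchwartzMap.compSubConstCLM ℝ x₀ (SchwartzMap.compCLMOfContinuousLinearEquiv ℝ L f),
    fun x => rfl, fun ξ => ?_⟩
  rw [Real.fourier_eq, Real.fourier_eq]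
  have h1 : (fun v => 𝐞 (-inner ℝ v ξ) • (SchwartzMap.compSubConstCLM ℝ x₀
      (SchwartzMap.compCLMOfContinuousLinearEquiv ℝ L f)) v) = fun v =>
      (fun y => 𝐞 (-inner ℝ (c⁻¹ • y + x₀) ξ) • f y) (c • (v - x₀)) := by
    ext v
    simp only [smul_smul, inv_mul_cancel₀ hc.ne', one_smul, sub_add_cancel]
    rfl
  rw [h1, integral_sub_right_eq_self (fun v => (fun y => 𝐞 (-inner ℝ (c⁻¹ • y + x₀) ξ) • f y)
    (c • v)) x₀, Measure.integral_comp_smul_of_nonneg volume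
    (fun y => 𝐞 (-inner ℝ (c⁻¹ • y + x₀) ξ) • f y) c (hR := hc.le),
    Circle.smul_def (𝐞 (-inner ℝ x₀ ξ)), ← integral_smul (𝐞 (-inner ℝ x₀ ξ) : ℂ)]
  refine congrArg _ (integral_congr_ae (.of_forall fun y => ?_))
  beta_reduce
  rw [← Circle.smul_def, smul_smul, ← AddChar.map_add_eq_mul]
  congr 3
  simp only [inner_add_left, inner_smul_left, inner_smul_right, RCLike.conj_to_real]
  ring

theorem SchwartzMap.fourier_iterate_lineDerivOp {V : Type*} [NormedAddCommGroup V]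
    [InnerProductSpace ℝ V] [FiniteDimensional ℝ V] [MeasurableSpace V] [BorelSpace V]
    (f : 𝓢(V, ℂ)) (e : V) (N : ℕ) (ξ : V) :
    𝓕 (((fun g : 𝓢(V, ℂ) => ∂_{e} g)^[N] f : 𝓢(V, ℂ)) : V → ℂ) ξ =
      (2 * Real.pi * Complex.I * (inner ℝ ξ e : ℝ)) ^ N * 𝓕 (f : V → ℂ) ξ := by
  induction N with
  | zero => simp
  | succ N ih =>
    have hg : (inner ℝ · e : V → ℝ).HasTemperateGrowth := ((innerSL ℝ).flip e).hasTemperateGrowth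
    rw [Function.iterate_succ_apply', ← SchwartzMap.fourier_coe, SchwartzMap.fourier_lineDerivOp_eq]
    rw [_root_.smul_apply, SchwartzMap.smulLeftCLM_apply_apply hg,
      SchwartzMap.fourier_coe, ih, pow_succ]
    simp only [smul_eq_mul, Complex.real_smul]
    ring

theorem tsupport_iterate_lineDerivOp_subset {V : Type*} [NormedAddCommGroup V]
    [NormedSpace ℝ V] (f : 𝓢(V, ℂ)) (e : V) (N : ℕ) :
    tsupport ((fun g : 𝓢(V, ℂ) => ∂_{e} g)^[N] f : 𝓢(V, ℂ)) ⊆ tsupport f := by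
  induction N with
  | zero => rfl
  | succ N ih =>
    rw [Function.iterate_succ_apply']
    exact (SchwartzMap.tsupport_lineDerivOp_subset e _).trans ih

/-- Integrating by parts `q` times moves `q` derivatives onto a `C^q` function. -/
theorem ContDiff.exists_integral_mul_conj_iterate_lineDerivOp {V : Type*} [NormedAddCommGroup V]
    [InnerProductSpace ℝ V] [FiniteDimensional ℝ V] [MeasurableSpace V] [BorelSpace V]
    (e : V) (q : ℕ) {f : V → ℂ} (hf : ContDiff ℝ (q : ℕ∞) f) :
    ∃ F : V → ℂ, Continuous F ∧ ∀ g : 𝓢(V, ℂ), HasCompactSupport g →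
      ∫ x, f x * (starRingEnd ℂ) (((fun g : 𝓢(V, ℂ) => ∂_{e} g)^[q] g) x) =
        ∫ x, F x * (starRingEnd ℂ) (g x) := by
  induction q generalizing f with
  | zero => exact ⟨f, hf.continuous, fun g _ => rfl⟩
  | succ q ih =>
    have hf1 : ContDiff ℝ (q : ℕ∞) fun x => -fderiv ℝ f x e := by
      refine (ContDiff.clm_apply ?_ contDiff_const).neg
      exact hf.fderiv_right (by norm_cast)
    obtain ⟨F, hF, hFg⟩ := ih hf1
    refine ⟨F, hF, fun g hg => ?_⟩
    rw [← hFg g hg]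
    set G : 𝓢(V, ℂ) := (fun g : 𝓢(V, ℂ) => ∂_{e} g)^[q] g
    have hG : HasCompactSupport G :=
      hg.of_isClosed_subset (isClosed_tsupport _) (tsupport_iterate_lineDerivOp_subset g e q)
    have hG' : HasCompactSupport (∂_{e} G : 𝓢(V, ℂ)) :=
      hG.of_isClosed_subset (isClosed_tsupport _) (SchwartzMap.tsupport_lineDerivOp_subset e _)
    rw [Function.iterate_succ_apply']
    let B : ℂ →L[ℝ] ℂ →L[ℝ] ℂ :=
      (ContinuousLinearMap.mul ℝ ℂ).bilinearComp (.id ℝ ℂ) Complex.conjCLE.toContinuousLinearMap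
    have hint : ∀ (a : V → ℂ) (h : 𝓢(V, ℂ)), Continuous a → HasCompactSupport h →
        Integrable fun x => a x * (starRingEnd ℂ) (h x) := by
      intro a h ha hh
      refine (ha.mul (Complex.continuous_conj.comp h.continuous)).integrable_of_hasCompactSupport ?_
      exact (hh.comp_left (map_zero _)).mul_left
    have h1 := integral_bilinear_fderiv_right_eq_neg_left_of_integrable (μ := volume) (f := f)
      (g := G) (v := e) (B := B) ?_ ?_ ?_ ?_ ?_
    · simp only [B, neg_mul, integral_neg] at h1 ⊢
      exact h1
    · simpa [B] using (hint _ G hf1.continuous hG).neg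
    · exact hint f (∂_{e} G) hf.continuous hG'
    · exact hint f G hf.continuous hG
    · exact fun x _ => (hf.differentiable (by simp)).differentiableAt
    · exact fun x _ => G.differentiableAt

theorem one_le_max_self_inv {r : ℝ} (hr : 0 < r) : 1 ≤ max r r⁻¹ := by
  rcases le_total 1 r with h | h
  · exact h.trans (le_max_left _ _)
  · exact ((one_le_inv₀ hr).2 h).trans (le_max_right _ _)

theorem sum_inv_max_div_two_pow_le {T : ℝ} (hT : 0 < T) (K : ℕ) :
    ∑ k ∈ Finset.range K, (max (T / 2 ^ k) (T / 2 ^ k)⁻¹)⁻¹ ≤ 6 := by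
  let F : ℝ → ℝ := fun x => x / (1 + x)
  have hF : ∀ x : ℝ, 0 < x → (max x x⁻¹)⁻¹ ≤ 6 * (F x - F (x / 2)) := by
    intro x hx
    have h1 : F x - F (x / 2) = x / ((1 + x) * (2 + x)) := by
      simp only [F]; field_simp; ring
    rw [h1, ← mul_div_assoc, le_div_iff₀ (by positivity)]
    rcases le_total 1 x with h | h
    · rw [max_eq_left (((inv_le_one₀ hx).2 h).trans h), inv_mul_le_iff₀ hx]
      nlinarith
    · rw [max_eq_right (h.trans ((one_le_inv₀ hx).2 h)), inv_inv]
      nlinarith [mul_nonneg hx.le (sub_nonneg.2 h),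
        mul_nonneg (mul_nonneg hx.le hx.le) (sub_nonneg.2 h)]
  have hF0 : ∀ x : ℝ, 0 < x → 0 ≤ F x := fun x hx => by positivity
  have hF1 : ∀ x : ℝ, 0 < x → F x ≤ 1 := fun x hx => by
    rw [div_le_one (by positivity)]; linarith
  suffices h : ∑ k ∈ Finset.range K, (max (T / 2 ^ k) (T / 2 ^ k)⁻¹)⁻¹ ≤
      6 * (F T - F (T / 2 ^ K)) by
    linarith [hF0 (T / 2 ^ K) (by positivity), hF1 T hT]
  induction K with
  | zero => simp
  | succ K ih =>
    rw [Finset.sum_range_succ]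
    have h2 := hF (T / 2 ^ K) (by positivity)
    rw [div_div, ← pow_succ] at h2
    linarith

section JapaneseBracket

variable {V : Type*} [NormedAddCommGroup V]

theorem one_le_sqrt_one_add_norm_sq (ξ : V) : 1 ≤ √(1 + ‖ξ‖ ^ 2) :=
  Real.one_le_sqrt.2 (by nlinarith [sq_nonneg ‖ξ‖])

theorem norm_le_sqrt_one_add_norm_sq (ξ : V) : ‖ξ‖ ≤ √(1 + ‖ξ‖ ^ 2) :=
  Real.le_sqrt_of_sq_le (by linarith)

theorem sqrt_one_add_norm_sq_le' (ξ : V) : √(1 + ‖ξ‖ ^ 2) ≤ 1 + ‖ξ‖ :=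
  Real.sqrt_le_iff.2 ⟨by positivity, by nlinarith [norm_nonneg ξ]⟩

variable [NormedSpace ℝ V]

theorem norm_comp_inv_smul_le {Ψ : V → ℂ} {C : ℝ} {Q : ℕ}
    (h1 : ∀ η, ‖η‖ ≤ 1 → ‖Ψ η‖ ≤ C * ‖η‖ ^ Q) (h2 : ∀ η, (1 + ‖η‖) ^ Q * ‖Ψ η‖ ≤ C)
    {b : ℝ} (hb : 1 ≤ b) (ξ : V) :
    ‖Ψ (b⁻¹ • ξ)‖ ≤ C * (max (√(1 + ‖ξ‖ ^ 2) / b) (√(1 + ‖ξ‖ ^ 2) / b)⁻¹)⁻¹ ^ Q := by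
  have hC : 0 ≤ C := (by positivity : (0 : ℝ) ≤ (1 + ‖(0 : V)‖) ^ Q * ‖Ψ 0‖).trans (h2 0)
  have hb0 : 0 < b := by linarith
  have hn : ‖b⁻¹ • ξ‖ = ‖ξ‖ / b := by
    rw [norm_smul, norm_inv, Real.norm_of_nonneg hb0.le, div_eq_inv_mul]
  have hT := one_le_sqrt_one_add_norm_sq ξ
  have hT1 := norm_le_sqrt_one_add_norm_sq ξ
  have hT2 := sqrt_one_add_norm_sq_le' ξ
  set T := √(1 + ‖ξ‖ ^ 2)
  have hr : 0 < T / b := by positivity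
  have hle : ‖b⁻¹ • ξ‖ ≤ T / b := by rw [hn]; gcongr
  rcases le_total (T / b) 1 with h | h
  · rw [max_eq_right (h.trans ((one_le_inv₀ hr).2 h)), inv_inv]
    refine (h1 _ (hle.trans h)).trans ?_
    gcongr
  · rw [max_eq_left (((inv_le_one₀ hr).2 h).trans h), inv_pow, ← div_eq_mul_inv,
      le_div_iff₀ (by positivity), mul_comm]
    refine le_trans ?_ (h2 (b⁻¹ • ξ))
    have : T / b ≤ 1 + ‖b⁻¹ • ξ‖ := by
      rw [hn, div_le_iff₀ hb0, add_mul, div_mul_cancel₀ _ hb0.ne']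
      linarith
    gcongr

theorem inv_max_pow_le {b : ℝ} (hb : 1 ≤ b) (ξ : V) (R : ℕ) :
    (max (√(1 + ‖ξ‖ ^ 2) / b) (√(1 + ‖ξ‖ ^ 2) / b)⁻¹)⁻¹ ^ R ≤
      2 ^ R * ((1 + ‖b⁻¹ • ξ‖) ^ R)⁻¹ := by
  have hb0 : 0 < b := by linarith
  have hn : ‖b⁻¹ • ξ‖ = ‖ξ‖ / b := by
    rw [norm_smul, norm_inv, Real.norm_of_nonneg hb0.le, div_eq_inv_mul]
  have hT := one_le_sqrt_one_add_norm_sq ξ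
  have hT1 := norm_le_sqrt_one_add_norm_sq ξ
  set T := √(1 + ‖ξ‖ ^ 2)
  have hr : 0 < T / b := by positivity
  have hM := one_le_max_self_inv hr
  have hle : ‖b⁻¹ • ξ‖ ≤ T / b := by rw [hn]; gcongr
  rw [← inv_pow, ← mul_pow]
  gcongr
  rw [inv_eq_one_div, ← div_eq_mul_inv, div_le_div_iff₀ (by positivity) (by positivity)]
  linarith [le_max_left (T / b) (T / b)⁻¹]

end JapaneseBracket

theorem rpow_mul_mul_le {T b φT φb C₁ C a X M : ℝ} {n q N : ℕ} (hT : 1 ≤ T) (hb : 1 ≤ b)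
    (hM : M = max (T / b) (T / b)⁻¹) (ha : 0 ≤ a) (hφT : 0 ≤ φT) (hφb : 0 ≤ φb) (hC₁ : 0 ≤ C₁)
    (hX0 : 0 ≤ X) (hφ : φT ≤ C₁ * M ^ N * φb)
    (hX : X ≤ C * M⁻¹ ^ (N + (q + n) + (n + 1))) :
    T ^ ((q : ℝ) + n / 2) * φT * (a * (b ^ q)⁻¹ * ((b ^ n)⁻¹ * X)) ≤
      C₁ * C * (a * φb) * (√(b ^ n))⁻¹ * M⁻¹ ^ (n + 1) := by
  have hb0 : 0 < b := by linarith
  have hr : 0 < T / b := by positivity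
  have hM1 : 1 ≤ M := hM ▸ one_le_max_self_inv hr
  have hM0 : 0 < M := by linarith
  have hs : (0 : ℝ) ≤ (q : ℝ) + n / 2 := by positivity
  have h1 : T ^ ((q : ℝ) + n / 2) ≤ b ^ q * √(b ^ n) * M ^ (q + n) := by
    have h2 : T = b * (T / b) := by field_simp
    rw [h2, Real.mul_rpow hb0.le hr.le, Real.rpow_add hb0, Real.rpow_natCast]
    have h3 : b ^ ((n : ℝ) / 2) = √(b ^ n) := by
      rw [Real.sqrt_eq_rpow, ← Real.rpow_natCast, ← Real.rpow_mul hb0.le]; ring_nf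
    rw [h3]
    gcongr
    calc (T / b) ^ ((q : ℝ) + n / 2) ≤ M ^ ((q : ℝ) + n / 2) :=
          Real.rpow_le_rpow hr.le (hM ▸ le_max_left _ _) hs
      _ ≤ M ^ ((q + n : ℕ) : ℝ) := by
          refine Real.rpow_le_rpow_of_exponent_le hM1 ?_
          push_cast
          linarith [(Nat.cast_nonneg n : (0 : ℝ) ≤ n)]
      _ = M ^ (q + n) := Real.rpow_natCast _ _
  have h4 : 0 < √(b ^ n) := Real.sqrt_pos.2 (by positivity)
  have h5 : b ^ n = √(b ^ n) * √(b ^ n) := (Real.mul_self_sqrt (by positivity)).symm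
  calc _ ≤ (b ^ q * √(b ^ n) * M ^ (q + n)) * (C₁ * M ^ N * φb) *
        (a * (b ^ q)⁻¹ * ((b ^ n)⁻¹ * (C * M⁻¹ ^ (N + (q + n) + (n + 1))))) := by
        gcongr
    _ = _ := by
        rw [pow_add M⁻¹ (N + (q + n)), pow_add M⁻¹ N, inv_pow, inv_pow, inv_pow]
        set S := √(b ^ n)
        rw [h5]
        field_simp

theorem lintegral_inv_mul_comp_inv_smul_lt_top (n : ℕ) : ∃ J : ℝ≥0∞, J < ⊤ ∧ ∀ b : ℝ, 1 ≤ b →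
    ∫⁻ ξ : EuclideanSpace ℝ (Fin n), ENNReal.ofReal
      ((b ^ n)⁻¹ * ((1 + ‖b⁻¹ • ξ‖) ^ (n + 1))⁻¹) = J := by
  have hi : Integrable fun ξ : EuclideanSpace ℝ (Fin n) => ((1 + ‖ξ‖) ^ (n + 1))⁻¹ := by
    have := integrable_one_add_norm (E := EuclideanSpace ℝ (Fin n)) (μ := volume)
      (r := (n + 1 : ℕ)) (by simp)
    refine this.congr (.of_forall fun x => ?_)
    simp only
    rw [Real.rpow_neg (by positivity), Real.rpow_natCast]
  refine ⟨_, ENNReal.ofReal_lt_top (r := ∫ ξ : EuclideanSpace ℝ (Fin n), ((1 + ‖ξ‖) ^ (n + 1))⁻¹),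
    fun b hb => ?_⟩
  have hb0 : 0 < b := by linarith
  have hi' := (hi.comp_smul (inv_ne_zero hb0.ne')).const_mul (b ^ n)⁻¹
  rw [← ofReal_integral_eq_lintegral_ofReal hi' (.of_forall fun x => by positivity),
    integral_const_mul, Measure.integral_comp_inv_smul_of_nonneg volume
      (fun ξ : EuclideanSpace ℝ (Fin n) => ((1 + ‖ξ‖) ^ (n + 1))⁻¹) hb0.le]
  simp [hb0.ne']

/-- An almost orthogonality estimate. -/
theorem hInt_tsum_lt_top {n : ℕ} {s : ℝ} {φ : ℝ → ℝ} (hpos : ∀ t, 1 ≤ t → 0 < φ t)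
    {w : ℕ → EuclideanSpace ℝ (Fin n) → ℂ} (hw : ∀ ξ, Summable fun k => w k ξ)
    {β : ℕ → ℝ} (hβ : Summable fun k => β k ^ 2)
    (hbd : ∀ k ξ, √(1 + ‖ξ‖ ^ 2) ^ s * φ √(1 + ‖ξ‖ ^ 2) * ‖w k ξ‖ ≤
      β k * (√((2 ^ k) ^ n))⁻¹ *
        (max (√(1 + ‖ξ‖ ^ 2) / 2 ^ k) (√(1 + ‖ξ‖ ^ 2) / 2 ^ k)⁻¹)⁻¹ ^ (n + 1)) :
    hInt n s φ (fun ξ => ∑' k, w k ξ) < ⊤ := by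
  obtain ⟨J, hJ, hJb⟩ := lintegral_inv_mul_comp_inv_smul_lt_top n
  have h1k : ∀ k : ℕ, (1 : ℝ) ≤ 2 ^ k := fun k => one_le_pow₀ (by norm_num)
  set G : ℕ → EuclideanSpace ℝ (Fin n) → ℝ := fun k ξ =>
    ((2 ^ k) ^ n)⁻¹ * ((1 + ‖((2 : ℝ) ^ k)⁻¹ • ξ‖) ^ (n + 1))⁻¹
  have hG0 : ∀ k ξ, 0 ≤ G k ξ := fun k ξ => by positivity
  have hpt : ∀ ξ K, hWeight s φ ξ * ‖∑ k ∈ Finset.range K, w k ξ‖ ^ 2 ≤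
      ∑ k ∈ Finset.range K, 6 * 2 ^ (n + 1) * β k ^ 2 * G k ξ := by
    intro ξ K
    have hT := one_le_sqrt_one_add_norm_sq ξ
    have hbd' := fun k => hbd k ξ
    have hb2 := fun k => inv_max_pow_le (h1k k) ξ (n + 1)
    have hsq : (1 + ‖ξ‖ ^ 2) = √(1 + ‖ξ‖ ^ 2) ^ 2 := (Real.sq_sqrt (by positivity)).symm
    have hweight : hWeight s φ ξ = (√(1 + ‖ξ‖ ^ 2) ^ s * φ √(1 + ‖ξ‖ ^ 2)) ^ 2 := by
      rw [hWeight, mul_pow]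
      congr 1
      conv_lhs => rw [hsq]
      rw [Real.rpow_pow_comm (by positivity)]
    set T := √(1 + ‖ξ‖ ^ 2)
    have hω : 0 ≤ T ^ s * φ T := mul_nonneg (by positivity) (hpos T hT).le
    set M : ℕ → ℝ := fun k => max (T / 2 ^ k) (T / 2 ^ k)⁻¹
    have hM : ∀ k, 1 ≤ M k := fun k => one_le_max_self_inv (by positivity)
    have hM0 : ∀ k, 0 < M k := fun k => by linarith [hM k]
    have hu : ∑ k ∈ Finset.range K, (M k)⁻¹ ^ (n + 1) ≤ 6 := by
      refine le_trans (Finset.sum_le_sum fun k _ => ?_)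
        (sum_inv_max_div_two_pow_le (by linarith : 0 < T) K)
      exact pow_le_of_le_one (by have := hM0 k; positivity) (inv_le_one_of_one_le₀ (hM k)) (by simp)
    calc hWeight s φ ξ * ‖∑ k ∈ Finset.range K, w k ξ‖ ^ 2
        = (T ^ s * φ T * ‖∑ k ∈ Finset.range K, w k ξ‖) ^ 2 := by rw [hweight]; ring
      _ ≤ (∑ k ∈ Finset.range K, β k * (√((2 ^ k) ^ n))⁻¹ * (M k)⁻¹ ^ (n + 1)) ^ 2 := by
          refine pow_le_pow_left₀ (by positivity) ?_ 2
          refine (mul_le_mul_of_nonneg_left (norm_sum_le _ _) hω).trans ?_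
          rw [Finset.mul_sum]
          exact Finset.sum_le_sum fun k _ => hbd' k
      _ ≤ (∑ k ∈ Finset.range K, (M k)⁻¹ ^ (n + 1)) *
          ∑ k ∈ Finset.range K, β k ^ 2 * ((2 ^ k) ^ n)⁻¹ * (M k)⁻¹ ^ (n + 1) := by
          refine Finset.sum_sq_le_sum_mul_sum_of_sq_le_mul _ (fun k _ => ?_) (fun k _ => ?_)
            (fun k _ => ?_)
          · have := hM0 k; positivity
          · have := hM0 k; positivity
          · refine le_of_eq ?_
            rw [mul_pow, mul_pow, inv_pow (√_), Real.sq_sqrt (by positivity)]; ring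
      _ ≤ 6 * ∑ k ∈ Finset.range K, β k ^ 2 * ((2 ^ k) ^ n)⁻¹ * (M k)⁻¹ ^ (n + 1) := by
          refine mul_le_mul_of_nonneg_right hu (Finset.sum_nonneg fun k _ => ?_)
          have := hM0 k; positivity
      _ ≤ _ := by
          rw [Finset.mul_sum]
          refine Finset.sum_le_sum fun k _ => ?_
          have h3 : β k ^ 2 * ((2 ^ k) ^ n)⁻¹ * (M k)⁻¹ ^ (n + 1) ≤ β k ^ 2 * ((2 ^ k) ^ n)⁻¹ *
            (2 ^ (n + 1) * ((1 + ‖((2 : ℝ) ^ k)⁻¹ • ξ‖) ^ (n + 1))⁻¹) :=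
            mul_le_mul_of_nonneg_left (hb2 k) (by positivity)
          simp only [G]
          linarith
  have hlim : ∀ ξ, ENNReal.ofReal (hWeight s φ ξ * ‖∑' k, w k ξ‖ ^ 2) ≤
      ∑' k, ENNReal.ofReal (6 * 2 ^ (n + 1) * β k ^ 2 * G k ξ) := by
    intro ξ
    have ht : Tendsto (fun K => ENNReal.ofReal
        (hWeight s φ ξ * ‖∑ k ∈ Finset.range K, w k ξ‖ ^ 2)) atTop
        (nhds (ENNReal.ofReal (hWeight s φ ξ * ‖∑' k, w k ξ‖ ^ 2))) :=
      (ENNReal.continuous_ofReal.tendsto _).comp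
        ((((hw ξ).hasSum.tendsto_sum_nat.norm).pow 2).const_mul _)
    refine le_of_tendsto' ht fun K => ?_
    refine (ENNReal.ofReal_le_ofReal (hpt ξ K)).trans ?_
    rw [ENNReal.ofReal_sum_of_nonneg fun k _ => by have := hG0 k ξ; positivity]
    exact ENNReal.sum_le_tsum _
  calc hInt n s φ (fun ξ => ∑' k, w k ξ)
      ≤ ∫⁻ ξ, ∑' k, ENNReal.ofReal (6 * 2 ^ (n + 1) * β k ^ 2 * G k ξ) := lintegral_mono hlim
    _ = ∑' k, ∫⁻ ξ, ENNReal.ofReal (6 * 2 ^ (n + 1) * β k ^ 2 * G k ξ) :=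
        lintegral_tsum fun k => by fun_prop
    _ = ∑' k, ENNReal.ofReal (6 * 2 ^ (n + 1) * β k ^ 2) * J := by
        congr 1
        ext k
        rw [← hJb (2 ^ k) (h1k k), ← lintegral_const_mul' _ _ ENNReal.ofReal_ne_top]
        congr 1
        ext ξ
        rw [← ENNReal.ofReal_mul (by positivity)]
    _ = ENNReal.ofReal (∑' k, 6 * 2 ^ (n + 1) * β k ^ 2) * J := by
        rw [ENNReal.tsum_mul_right,
          ENNReal.ofReal_tsum_of_nonneg (fun k => by positivity) (hβ.mul_left _)]
    _ < ⊤ := ENNReal.mul_lt_top ENNReal.ofReal_lt_top hJ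

/-- Termwise integration of a series with rapidly decreasing polynomial bounds against a Schwartz
function. -/
theorem hasSum_integral_mul_conj_schwartzMap {V : Type*} [NormedAddCommGroup V]
    [InnerProductSpace ℝ V] [FiniteDimensional ℝ V] [MeasurableSpace V] [BorelSpace V]
    {w : ℕ → V → ℂ} (hw : ∀ k, Continuous (w k)) {D : ℝ} {Q : ℕ}
    (hbd : ∀ k ξ, ‖w k ξ‖ ≤ D * (1 / 2) ^ k * (1 + ‖ξ‖) ^ Q) (h : 𝓢(V, ℂ)) :
    HasSum (fun k => ∫ ξ, w k ξ * (starRingEnd ℂ) (h ξ))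
      (∫ ξ, (∑' k, w k ξ) * (starRingEnd ℂ) (h ξ)) := by
  have hD : 0 ≤ D := by simpa using (norm_nonneg _).trans (hbd 0 0)
  have hi : Integrable fun ξ => (1 + ‖ξ‖) ^ Q * ‖h ξ‖ := by
    have h1 : ∀ ξ : V, (1 + ‖ξ‖) ^ Q * ‖h ξ‖ ≤ 2 ^ Q * (‖h ξ‖ + ‖ξ‖ ^ Q * ‖h ξ‖) := by
      intro ξ
      have : (1 + ‖ξ‖) ^ Q ≤ 2 ^ Q * (1 + ‖ξ‖ ^ Q) := by
        have h3 := add_pow_le zero_le_one (norm_nonneg ξ) Q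
        rw [one_pow] at h3
        refine h3.trans ?_
        gcongr
        · norm_num
        · omega
      calc _ ≤ 2 ^ Q * (1 + ‖ξ‖ ^ Q) * ‖h ξ‖ := by gcongr
        _ = _ := by ring
    refine Integrable.mono' ((h.integrable.norm.add (h.integrable_pow_mul volume Q)).const_mul
      (2 ^ Q)) (by have := h.continuous; fun_prop) (.of_forall fun ξ => ?_)
    rw [Real.norm_of_nonneg (by positivity)]
    exact h1 ξ
  have hn : ∀ k ξ, ‖w k ξ * (starRingEnd ℂ) (h ξ)‖ ≤
      D * (1 / 2) ^ k * ((1 + ‖ξ‖) ^ Q * ‖h ξ‖) := by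
    intro k ξ
    rw [norm_mul, RCLike.norm_conj, ← mul_assoc]
    gcongr
    exact hbd k ξ
  have hint : ∀ k, Integrable fun ξ => w k ξ * (starRingEnd ℂ) (h ξ) := fun k =>
    Integrable.mono' (hi.const_mul (D * (1 / 2) ^ k))
      ((hw k).mul (Complex.continuous_conj.comp h.continuous)).aestronglyMeasurable
      (.of_forall (hn k))
  have := hasSum_integral_of_summable_integral_norm hint ?_
  · simpa only [tsum_mul_right] using this
  · refine Summable.of_nonneg_of_le (fun k => integral_nonneg fun ξ => norm_nonneg _)
      (fun k => integral_mono (hint k).norm (hi.const_mul (D * (1 / 2) ^ k)) (hn k)) ?_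
    simp only [integral_const_mul]
    exact ((summable_geometric_two).mul_left D).mul_right _

theorem exists_pos_le_integral_inner_pow_mul {V : Type*} [NormedAddCommGroup V]
    [InnerProductSpace ℝ V] [FiniteDimensional ℝ V] [MeasurableSpace V] [BorelSpace V]
    {p : V → ℝ} (hp : Continuous p) (hp0 : ∀ ξ, 0 ≤ p ξ) (hp1 : 0 < p 0) {e : V} (he : ‖e‖ = 1)
    (N : ℕ) :
    ∃ c > 0, ∀ t : ℝ, 0 ≤ t → t ≤ 1 →
      Integrable (fun η => (2 * Real.pi * inner ℝ η e) ^ (2 * N) * (p η * p (t • η))) →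
      c ≤ ∫ η, (2 * Real.pi * inner ℝ η e) ^ (2 * N) * (p η * p (t • η)) := by
  obtain ⟨δ, hδ, hball⟩ := Metric.eventually_nhds_iff_ball.1
    (hp.continuousAt.eventually (lt_mem_nhds (half_lt_self hp1)))
  set B : Set V := Metric.ball ((δ / 2) • e) (δ / 4)
  have hvol : 0 < volume.real B := ENNReal.toReal_pos
    (Metric.measure_ball_pos _ _ (by positivity)).ne' measure_ball_lt_top.ne
  set κ : ℝ := (2 * Real.pi * (δ / 4)) ^ (2 * N) * (p 0 / 2 * (p 0 / 2))
  have hκ : 0 < κ := by have := Real.pi_pos; positivity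
  refine ⟨κ * volume.real B, by positivity, fun t ht0 ht1 hi => ?_⟩
  have hnn : ∀ η, 0 ≤ (2 * Real.pi * inner ℝ η e) ^ (2 * N) * (p η * p (t • η)) := fun η =>
    mul_nonneg ((even_two_mul N).pow_nonneg _) (mul_nonneg (hp0 _) (hp0 _))
  refine le_trans ?_ (setIntegral_le_integral (s := B) hi (.of_forall hnn))
  have hle : ∀ η ∈ B, κ ≤ (2 * Real.pi * inner ℝ η e) ^ (2 * N) * (p η * p (t • η)) := by
    intro η hη
    have hd : ‖η - (δ / 2) • e‖ < δ / 4 := mem_ball_iff_norm.1 hη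
    have hη1 : ‖η‖ < δ := by
      have h1 := norm_le_norm_sub_add η ((δ / 2) • e)
      rw [norm_smul, he, Real.norm_of_nonneg (by positivity)] at h1
      linarith
    have hin : δ / 4 ≤ inner ℝ η e := by
      have h1 := (abs_le.1 (abs_real_inner_le_norm (η - (δ / 2) • e) e)).1
      rw [inner_sub_left, inner_smul_left, real_inner_self_eq_norm_sq, he] at h1
      simp only [RCLike.conj_to_real] at h1
      linarith
    have h2 : p 0 / 2 ≤ p η := (hball η (by simpa using hη1)).le
    have h3 : p 0 / 2 ≤ p (t • η) := by
      refine (hball _ ?_).le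
      rw [mem_ball_zero_iff, norm_smul, Real.norm_of_nonneg ht0]
      exact (mul_le_of_le_one_left (norm_nonneg _) ht1).trans_lt hη1
    have := Real.pi_pos
    have := hp0 η
    simp only [κ]
    gcongr
    exact (even_two_mul N).pow_nonneg _
  have := setIntegral_mono_on (μ := volume) (s := B) (f := fun _ => κ)
    (integrableOn_const measure_ball_lt_top.ne) hi.integrableOn measurableSet_ball hle
  rwa [setIntegral_const, smul_eq_mul, mul_comm] at this

theorem tsupport_subset_closedBall_of_comp_smul_sub {V : Type*} [NormedAddCommGroup V]
    [NormedSpace ℝ V] {f g : V → ℂ} {c ρ : ℝ} {x₀ : V} (hc : 1 ≤ c)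
    (hf : tsupport f ⊆ Metric.closedBall 0 ρ) (hg : ∀ x, g x = f (c • (x - x₀))) :
    tsupport g ⊆ Metric.closedBall x₀ ρ := by
  refine closure_minimal (fun x hx => ?_) Metric.isClosed_closedBall
  have h1 : c • (x - x₀) ∈ tsupport f := subset_tsupport f (by
    rw [Function.mem_support, ← hg]
    exact hx)
  have h2 := mem_closedBall_zero_iff.1 (hf h1)
  rw [norm_smul, Real.norm_of_nonneg (by linarith)] at h2
  rw [mem_closedBall_iff_norm]
  exact (le_mul_of_one_le_left (norm_nonneg _) hc).trans h2

section Fourier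

variable {V : Type*} [NormedAddCommGroup V] [InnerProductSpace ℝ V] [FiniteDimensional ℝ V]
  [MeasurableSpace V] [BorelSpace V]

theorem SchwartzMap.integral_fourier_mul_conj_fourier (f g : 𝓢(V, ℂ)) :
    ∫ ξ, 𝓕 (f : V → ℂ) ξ * (starRingEnd ℂ) (𝓕 (g : V → ℂ) ξ) =
      ∫ x, f x * (starRingEnd ℂ) (g x) := by
  have := SchwartzMap.integral_inner_fourier_fourier g f
  simpa only [RCLike.inner_apply, SchwartzMap.fourier_coe] using this

theorem SchwartzMap.exists_norm_fourier_iterate_lineDerivOp_le (f : 𝓢(V, ℂ)) {e : V}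
    (he : ‖e‖ = 1) {Q M : ℕ} (hQM : Q ≤ M) :
    ∃ C, (∀ η, ‖η‖ ≤ 1 →
        ‖𝓕 (((fun g : 𝓢(V, ℂ) => ∂_{e} g)^[M] f : 𝓢(V, ℂ)) : V → ℂ) η‖ ≤ C * ‖η‖ ^ Q) ∧
      ∀ η, (1 + ‖η‖) ^ Q *
        ‖𝓕 (((fun g : 𝓢(V, ℂ) => ∂_{e} g)^[M] f : 𝓢(V, ℂ)) : V → ℂ) η‖ ≤ C := by
  have hdec : ∀ (g : 𝓢(V, ℂ)) (k : ℕ), ∃ C, 0 ≤ C ∧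
      ∀ η, (1 + ‖η‖) ^ k * ‖𝓕 (g : V → ℂ) η‖ ≤ C := by
    intro g k
    have h := SchwartzMap.one_add_le_sup_seminorm_apply (𝕜 := ℝ) (m := (k, 0)) le_rfl le_rfl (𝓕 g)
    simp only [norm_iteratedFDeriv_zero, SchwartzMap.fourier_coe] at h
    exact ⟨_, (by positivity : (0 : ℝ) ≤ (1 + ‖(0 : V)‖) ^ k * ‖𝓕 (g : V → ℂ) 0‖).trans (h 0), h⟩
  obtain ⟨C₀, hC₀, h0⟩ := hdec f 0
  obtain ⟨C₁, hC₁, h1⟩ := hdec ((fun g : 𝓢(V, ℂ) => ∂_{e} g)^[M] f) Q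
  have hpi := Real.pi_pos
  refine ⟨(2 * Real.pi) ^ M * C₀ + C₁, fun η hη => ?_, fun η => (h1 η).trans
    (le_add_of_nonneg_left (by positivity))⟩
  have h2 : ‖𝓕 (f : V → ℂ) η‖ ≤ C₀ := by simpa using h0 η
  have h3 : |inner ℝ η e| ≤ ‖η‖ := by simpa [he] using abs_real_inner_le_norm η e
  rw [SchwartzMap.fourier_iterate_lineDerivOp, norm_mul, norm_pow]
  have h4 : ‖2 * (Real.pi : ℂ) * Complex.I * ((inner ℝ η e : ℝ) : ℂ)‖ =
      2 * Real.pi * |inner ℝ η e| := by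
    simp [abs_of_pos hpi]
  rw [h4]
  calc (2 * Real.pi * |inner ℝ η e|) ^ M * ‖𝓕 (f : V → ℂ) η‖
      ≤ (2 * Real.pi * ‖η‖) ^ M * C₀ := by gcongr
    _ = (2 * Real.pi) ^ M * C₀ * ‖η‖ ^ M := by ring
    _ ≤ (2 * Real.pi) ^ M * C₀ * ‖η‖ ^ Q :=
        mul_le_mul_of_nonneg_left (pow_le_pow_of_le_one (norm_nonneg _) hη hQM) (by positivity)
    _ ≤ _ := by
        gcongr
        linarith

/-- The pairing of two dilates of derivatives of a function with nonnegative Fourier transform is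
nonnegative, with a uniform lower bound if the second one is more concentrated. -/
theorem exists_pos_pairing_fourier {θ : 𝓢(V, ℂ)} {p : V → ℝ} (hp : Continuous p)
    (hp0 : ∀ ξ, 0 ≤ p ξ) (hp1 : 0 < p 0) (hθ : ∀ ξ, 𝓕 (θ : V → ℂ) ξ = p ξ) {e : V}
    (he : ‖e‖ = 1) (q Q : ℕ) (x₀ : V) :
    ∃ c₀ > 0, ∀ c d : ℝ, 0 < c → 0 < d → ∀ g γ : 𝓢(V, ℂ),
      (∀ ξ, 𝓕 (g : V → ℂ) ξ = (c ^ Module.finrank ℝ V)⁻¹ • ((𝐞 (-inner ℝ x₀ ξ)) •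
        𝓕 (((fun g : 𝓢(V, ℂ) => ∂_{e} g)^[q + 4 * Q] θ : 𝓢(V, ℂ)) : V → ℂ) (c⁻¹ • ξ))) →
      (∀ ξ, 𝓕 (γ : V → ℂ) ξ = (d ^ Module.finrank ℝ V)⁻¹ • ((𝐞 (-inner ℝ x₀ ξ)) •
        𝓕 (θ : V → ℂ) (d⁻¹ • ξ))) →
      ∃ r : ℝ, 0 ≤ r ∧ (c ≤ d → c₀ ≤ r) ∧
        ((c ^ q)⁻¹ : ℝ) * ∫ ξ, 𝓕 (g : V → ℂ) ξ * (starRingEnd ℂ)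
          (𝓕 (((fun g : 𝓢(V, ℂ) => ∂_{e} g)^[q] γ : 𝓢(V, ℂ)) : V → ℂ) ξ) =
            (((d ^ Module.finrank ℝ V)⁻¹ * r : ℝ) : ℂ) := by
  obtain ⟨c₀, hc₀, hc₀'⟩ := exists_pos_le_integral_inner_pow_mul hp hp0 hp1 he (q + 2 * Q)
  refine ⟨c₀, hc₀, fun c d hc hd g γ hg hγ => ?_⟩
  let H : V → ℝ := fun η =>
    (2 * Real.pi * inner ℝ η e) ^ (2 * (q + 2 * Q)) * (p η * p ((c / d) • η))
  have hH0 : ∀ η, 0 ≤ H η := fun η =>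
    mul_nonneg ((even_two_mul _).pow_nonneg _) (mul_nonneg (hp0 _) (hp0 _))
  set K : ℝ := (c ^ Module.finrank ℝ V)⁻¹ * (d ^ Module.finrank ℝ V)⁻¹ * c ^ q
  have hK : 0 < K := by positivity
  have hprod : ∀ ξ, 𝓕 (g : V → ℂ) ξ * (starRingEnd ℂ)
      (𝓕 (((fun g : 𝓢(V, ℂ) => ∂_{e} g)^[q] γ : 𝓢(V, ℂ)) : V → ℂ) ξ) =
        ((K * H (c⁻¹ • ξ) : ℝ) : ℂ) := by
    intro ξ
    rw [hg, SchwartzMap.fourier_iterate_lineDerivOp, SchwartzMap.fourier_iterate_lineDerivOp, hγ,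
      hθ, hθ]
    have h1 : (c / d) • c⁻¹ • ξ = d⁻¹ • ξ := by
      rw [smul_smul]; congr 1; field_simp
    have h2 : inner ℝ ξ e = c * inner ℝ (c⁻¹ • ξ) e := by
      rw [inner_smul_left]; simp [hc.ne']
    simp only [H, h1, h2]
    set u := inner ℝ (c⁻¹ • ξ) e
    have hI : Complex.I ^ (q + 4 * Q) * (-Complex.I) ^ q = 1 := by
      rw [pow_add, pow_mul, Complex.I_pow_four, one_pow, mul_one, ← mul_pow]
      simp
    simp only [Circle.smul_def, Complex.real_smul, smul_eq_mul, map_mul, map_pow, Complex.conj_I,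
      Complex.conj_ofReal, map_ofNat]
    simp only [K]
    push_cast
    set z : ℂ := (𝐞 (-inner ℝ x₀ ξ) : ℂ)
    have hz : z * (starRingEnd ℂ) z = 1 := by
      rw [Complex.mul_conj, Circle.normSq_coe, Complex.ofReal_one]
    generalize -Complex.I = J at hI ⊢
    calc _ = (z * (starRingEnd ℂ) z) * (Complex.I ^ (q + 4 * Q) * J ^ q) *
          (((c : ℂ) ^ Module.finrank ℝ V)⁻¹ * ((d : ℂ) ^ Module.finrank ℝ V)⁻¹ * c ^ q *
          ((2 * Real.pi * u) ^ (2 * (q + 2 * Q)) * (p (c⁻¹ • ξ) * p (d⁻¹ • ξ)))) := by ring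
      _ = _ := by rw [hz, hI, one_mul, one_mul]
  have hint : Integrable fun ξ => ((K * H (c⁻¹ • ξ) : ℝ) : ℂ) := by
    simp_rw [← hprod, ← SchwartzMap.fourier_coe]
    exact (SchwartzMap.memLp (𝓕 g) 2 volume).integrable_mul
      (SchwartzMap.memLp (𝓕 ((fun g : 𝓢(V, ℂ) => ∂_{e} g)^[q] γ)) 2 volume).star
  have hint' : Integrable fun ξ => H (c⁻¹ • ξ) := by
    have := (hint.re.const_mul K⁻¹)
    refine this.congr (.of_forall fun ξ => ?_)
    simp [hK.ne']
  have hHi : Integrable H := by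
    have := hint'.comp_smul hc.ne'
    simpa [smul_smul, hc.ne'] using this
  refine ⟨∫ η, H η, integral_nonneg hH0, fun hcd => hc₀' (c / d) (by positivity)
    ((div_le_one hd).2 hcd) hHi, ?_⟩
  simp_rw [hprod]
  rw [integral_complex_ofReal, integral_const_mul,
    Measure.integral_comp_inv_smul_of_nonneg volume H hc.le, ← Complex.ofReal_mul]
  congr 1
  simp only [K, smul_eq_mul]
  field_simp

end Fourier

theorem mul_le_mul_half_pow {φ a : ℕ → ℝ} {B C : ℝ} {N Q : ℕ} (hφ : ∀ k, 0 < φ k)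
    (ha : ∀ k, 0 ≤ a k) (hB : ∀ k, a k * φ k ≤ B) (hC : 0 ≤ C)
    (hN : ∀ k, φ 0 ≤ C * (2 ^ k) ^ N * φ k) (hQ : N + 1 ≤ Q) (k : ℕ) :
    a k * ((2 ^ k) ^ Q)⁻¹ ≤ B * C / φ 0 * (1 / 2) ^ k := by
  have h2 : (1 : ℝ) ≤ 2 ^ k := one_le_pow₀ (by norm_num)
  have h3 : ((2 : ℝ) ^ k) ^ (N + 1) ≤ (2 ^ k) ^ Q := pow_le_pow_right₀ h2 hQ
  have h4 : a k * φ 0 ≤ B * C * (2 ^ k) ^ N := by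
    calc a k * φ 0 ≤ a k * (C * (2 ^ k) ^ N * φ k) := mul_le_mul_of_nonneg_left (hN k) (ha k)
      _ = C * (2 ^ k) ^ N * (a k * φ k) := by ring
      _ ≤ C * (2 ^ k) ^ N * B := mul_le_mul_of_nonneg_left (hB k) (by positivity)
      _ = _ := by ring
  have h5 := hφ 0
  have h6 := ha k
  calc a k * ((2 ^ k) ^ Q)⁻¹ ≤ a k * ((2 ^ k) ^ (N + 1))⁻¹ := by gcongr
    _ = a k * φ 0 * ((2 ^ k) ^ (N + 1))⁻¹ / φ 0 := by field_simp
    _ ≤ B * C * (2 ^ k) ^ N * ((2 ^ k) ^ (N + 1))⁻¹ / φ 0 := by gcongr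
    _ = _ := by
      rw [pow_succ ((2 : ℝ) ^ k), one_div, inv_pow]
      field_simp

/-- Converse of Hörmander's embedding theorem: if `∫₁^∞ dt/(tφ²(t)) = ∞`, then there is a
distribution `w ∈ H^{q+n/2,φ}(ℝⁿ)` (given by its Fourier transform `W` and acting on
Schwartz functions by `g ↦ ∫ W conj(𝓕g)`), with compact support contained in `G`, which
is not a `C^q` function. -/
theorem hormander_embedding_converse (n : ℕ) (hn : 1 ≤ n) (q : ℕ)
    (φ : ℝ → ℝ) (hφ : MClass φ) (hcont : ContinuousOn φ (Set.Ici (1:ℝ)))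
    (hdiv : (∫⁻ t in Set.Ioi (1:ℝ), ENNReal.ofReal (1 / (t * (φ t) ^ 2))) = ⊤)
    (G : Set (EuclideanSpace ℝ (Fin n))) (hG : IsOpen G) (hGne : G.Nonempty) :
    ∃ W : EuclideanSpace ℝ (Fin n) → ℂ, Measurable W ∧
      hInt n ((q : ℝ) + n / 2) φ W < ⊤ ∧
      (∃ K : Set (EuclideanSpace ℝ (Fin n)), IsCompact K ∧ K ⊆ G ∧
        ∀ g : 𝓢(EuclideanSpace ℝ (Fin n), ℂ), Disjoint (tsupport ⇑g) K →
          ∫ ξ, W ξ * (starRingEnd ℂ) (𝓕 ⇑g ξ) = 0) ∧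
      ¬ ∃ f : EuclideanSpace ℝ (Fin n) → ℂ, ContDiff ℝ (q : ℕ∞) f ∧
        ∀ g : 𝓢(EuclideanSpace ℝ (Fin n), ℂ),
          ∫ x, f x * (starRingEnd ℂ) (g x) = ∫ ξ, W ξ * (starRingEnd ℂ) (𝓕 ⇑g ξ) := by
  obtain ⟨-, hpos, -, hslow⟩ := hφ
  obtain ⟨C₁, hC₁, N, hpot⟩ := exists_le_mul_max_pow_mul hpos hslow hcont
  have h1k : ∀ k : ℕ, (1 : ℝ) ≤ 2 ^ k := fun k => one_le_pow₀ (by norm_num)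
  have hposk : ∀ k : ℕ, 0 < φ (2 ^ k) := fun k => hpos _ (h1k k)
  obtain ⟨a, ha, hans, ha2⟩ := exists_not_summable_summable_sq_div
    (fun k => inv_pos.2 (pow_pos (hposk k) 2))
    (not_summable_inv_sq_of_lintegral_eq_top hC₁ hpos hpot hdiv)
  have haφ : Summable fun k => (a k * φ (2 ^ k)) ^ 2 := by
    simpa only [div_inv_eq_mul, ← mul_pow] using ha2
  have hB : ∀ k, a k * φ (2 ^ k) ≤ 1 + ∑' k, (a k * φ (2 ^ k)) ^ 2 := fun k => by
    have := haφ.le_tsum k fun _ _ => sq_nonneg _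
    nlinarith [sq_nonneg (a k * φ (2 ^ k) - 1)]
  obtain ⟨x₀, hx₀⟩ := hGne
  obtain ⟨ρ, hρ, hρG⟩ := Metric.nhds_basis_closedBall.mem_iff.1 (hG.mem_nhds hx₀)
  obtain ⟨θ, p, hp, hp0, hp1, hθ, hθρ⟩ :=
    exists_schwartzMap_fourier_nonneg (EuclideanSpace ℝ (Fin n)) hρ
  set e : EuclideanSpace ℝ (Fin n) := EuclideanSpace.single ⟨0, hn⟩ 1
  have he : ‖e‖ = 1 := by simp [e]
  set Q := N + (q + n) + (n + 1)
  obtain ⟨C, hC, hC'⟩ :=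
    θ.exists_norm_fourier_iterate_lineDerivOp_le he (Q := Q) (M := q + 4 * Q) (by omega)
  obtain ⟨c₀, hc₀, hpair⟩ := exists_pos_pairing_fourier hp hp0 hp1 hθ he q Q x₀
  set ψ : 𝓢(EuclideanSpace ℝ (Fin n), ℂ) := (fun g => ∂_{e} g)^[q + 4 * Q] θ
  have hψρ : tsupport ψ ⊆ Metric.closedBall 0 ρ :=
    (tsupport_iterate_lineDerivOp_subset θ e _).trans hθρ
  have h0k : ∀ k : ℕ, (0 : ℝ) < 2 ^ k := fun k => by positivity
  choose g hg hgF using fun k : ℕ => ψ.exists_comp_smul_sub (h0k k) x₀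
  choose γ hγ hγF using fun k : ℕ => θ.exists_comp_smul_sub (h0k k) x₀
  have hgρ : ∀ k, tsupport (g k) ⊆ Metric.closedBall x₀ ρ := fun k =>
    tsupport_subset_closedBall_of_comp_smul_sub (h1k k) hψρ (hg k)
  have hγρ : ∀ k, tsupport (γ k) ⊆ Metric.closedBall x₀ ρ := fun k =>
    tsupport_subset_closedBall_of_comp_smul_sub (h1k k) hθρ (hγ k)
  set w : ℕ → EuclideanSpace ℝ (Fin n) → ℂ := fun k ξ =>
    ((a k * ((2 ^ k) ^ q)⁻¹ : ℝ) : ℂ) * 𝓕 (g k : EuclideanSpace ℝ (Fin n) → ℂ) ξ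
  have hwc : ∀ k, Continuous (w k) := fun k => by
    simp only [w, ← SchwartzMap.fourier_coe]
    exact continuous_const.mul (𝓕 (g k)).continuous
  have hwn : ∀ k ξ, ‖w k ξ‖ = a k * ((2 ^ k) ^ q)⁻¹ * (((2 ^ k) ^ n)⁻¹ *
      ‖𝓕 (ψ : EuclideanSpace ℝ (Fin n) → ℂ) (((2 : ℝ) ^ k)⁻¹ • ξ)‖) := by
    intro k ξ
    simp only [w, hgF, norm_mul, Complex.norm_real, norm_smul, finrank_euclideanSpace_fin,
      Circle.norm_smul]
    rw [Real.norm_of_nonneg (ha k), Real.norm_of_nonneg (by positivity),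
      Real.norm_of_nonneg (by positivity)]
  have hΨ := fun k ξ => norm_comp_inv_smul_le hC hC' (h1k k) ξ
  have hbd : ∀ k ξ, ‖w k ξ‖ ≤ (1 + ∑' k, (a k * φ (2 ^ k)) ^ 2) * C₁ / φ 1 * C * (1 / 2) ^ k *
      (1 + ‖ξ‖) ^ Q := by
    intro k ξ
    have h2 := mul_le_mul_half_pow (φ := fun k => φ (2 ^ k)) hposk ha hB hC₁.le (N := N) (Q := Q)
      (fun k => by
        have := hpot (2 ^ k) 1 (h1k k) le_rfl
        rwa [div_one, max_eq_right ((div_le_self zero_le_one (h1k k)).trans (h1k k)),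
          ← pow_zero (2 : ℝ)] at this)
      (by omega) k
    rw [pow_zero] at h2
    have hT := sqrt_one_add_norm_sq_le' ξ
    have hT1 := one_le_sqrt_one_add_norm_sq ξ
    have h3 := hΨ k ξ
    have hC0 : 0 ≤ C := (by positivity : (0 : ℝ) ≤ (1 + ‖(0 : EuclideanSpace ℝ (Fin n))‖) ^ Q *
      ‖𝓕 (ψ : EuclideanSpace ℝ (Fin n) → ℂ) 0‖).trans (hC' 0)
    set T := √(1 + ‖ξ‖ ^ 2)
    have h4 : (max (T / 2 ^ k) (T / 2 ^ k)⁻¹)⁻¹ ≤ (1 + ‖ξ‖) / 2 ^ k := by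
      refine (inv_le_of_inv_le₀ (by positivity) (le_max_right _ _)).trans ?_
      gcongr
    have h5 := ha k
    rw [hwn]
    calc _ ≤ a k * 1 * (1 * (C * ((1 + ‖ξ‖) / 2 ^ k) ^ Q)) := by
          gcongr
          · exact inv_le_one_of_one_le₀ (one_le_pow₀ (h1k k))
          · exact inv_le_one_of_one_le₀ (one_le_pow₀ (h1k k))
          · refine h3.trans ?_
            gcongr
      _ = a k * ((2 ^ k) ^ Q)⁻¹ * (C * (1 + ‖ξ‖) ^ Q) := by rw [div_pow]; ring
      _ ≤ (1 + ∑' k, (a k * φ (2 ^ k)) ^ 2) * C₁ / φ 1 * (1 / 2) ^ k * (C * (1 + ‖ξ‖) ^ Q) := by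
          gcongr
      _ = _ := by ring
  have hws : ∀ ξ, Summable fun k => w k ξ := fun ξ =>
    Summable.of_norm_bounded ((summable_geometric_two.mul_left _).mul_right _) (hbd · ξ)
  have hsum := fun h : 𝓢(EuclideanSpace ℝ (Fin n), ℂ) =>
    hasSum_integral_mul_conj_schwartzMap hwc hbd (𝓕 h)
  simp only [SchwartzMap.fourier_coe] at hsum
  have hterm : ∀ k (h : 𝓢(EuclideanSpace ℝ (Fin n), ℂ)),
      ∫ ξ, w k ξ * (starRingEnd ℂ) (𝓕 (h : EuclideanSpace ℝ (Fin n) → ℂ) ξ) =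
        ((a k * ((2 ^ k) ^ q)⁻¹ : ℝ) : ℂ) *
          ∫ ξ, 𝓕 (g k : EuclideanSpace ℝ (Fin n) → ℂ) ξ *
            (starRingEnd ℂ) (𝓕 (h : EuclideanSpace ℝ (Fin n) → ℂ) ξ) := by
    intro k h
    simp only [w, mul_assoc]
    rw [integral_const_mul]
  refine ⟨fun ξ => ∑' k, w k ξ, ?_, ?_, ⟨Metric.closedBall x₀ ρ, isCompact_closedBall _ _, hρG,
    fun h hh => ?_⟩, ?_⟩
  · refine measurable_of_tendsto_metrizable
      (fun K => Finset.measurable_sum (Finset.range K) fun k _ => (hwc k).measurable)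
      (tendsto_pi_nhds.2 fun ξ => ?_)
    simpa only [Finset.sum_apply] using (hws ξ).hasSum.tendsto_sum_nat
  · refine hInt_tsum_lt_top hpos hws (β := fun k => C₁ * C * (a k * φ (2 ^ k))) ?_ fun k ξ => ?_
    · simpa only [mul_pow] using (haφ.mul_left ((C₁ * C) ^ 2)).congr fun k => by ring
    · have hT := one_le_sqrt_one_add_norm_sq ξ
      rw [hwn]
      refine rpow_mul_mul_le hT (h1k k) rfl (ha k) (hpos _ hT).le (hposk k).le hC₁.le
        (norm_nonneg _) ?_ (hΨ k ξ)
      rw [inv_div]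
      exact hpot _ _ (h1k k) hT
  · refine (hsum h).unique ?_
    convert hasSum_zero with k
    rw [hterm, SchwartzMap.integral_fourier_mul_conj_fourier, integral_eq_zero_of_ae, mul_zero]
    refine .of_forall fun x => ?_
    by_cases hx : x ∈ tsupport h
    · have : x ∉ tsupport (g k) := fun hx' => hh.le_bot ⟨hx, hgρ k hx'⟩
      simp [image_eq_zero_of_notMem_tsupport this]
    · simp [image_eq_zero_of_notMem_tsupport hx]
  · rintro ⟨f, hf, hfW⟩
    obtain ⟨F, hF, hFg⟩ := hf.exists_integral_mul_conj_iterate_lineDerivOp e q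
    obtain ⟨B, hB⟩ := (isCompact_closedBall x₀ ρ).exists_bound_of_continuousOn hF.continuousOn
    have hupper : ∀ m, ‖∫ x, F x * (starRingEnd ℂ) (γ m x)‖ ≤
        ((2 ^ m) ^ n)⁻¹ * (B * ∫ x, ‖θ x‖) := by
      intro m
      have h1 : ∫ x, B * ‖γ m x‖ = ((2 ^ m) ^ n)⁻¹ * (B * ∫ x, ‖θ x‖) := by
        simp only [hγ, integral_const_mul]
        rw [integral_sub_right_eq_self (fun x => ‖θ ((2 : ℝ) ^ m • x)‖) x₀,
          Measure.integral_comp_smul_of_nonneg volume (fun x => ‖θ x‖) _ (hR := (h0k m).le),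
          finrank_euclideanSpace_fin, smul_eq_mul]
        ring
      rw [← h1]
      refine norm_integral_le_of_norm_le ((γ m).integrable.norm.const_mul B) (.of_forall fun x => ?_)
      rw [norm_mul, RCLike.norm_conj]
      by_cases hx : x ∈ tsupport (γ m)
      · exact mul_le_mul_of_nonneg_right (hB x (hγρ m hx)) (norm_nonneg _)
      · simp [image_eq_zero_of_notMem_tsupport hx]
    choose r hr0 hrc hr using fun k m => hpair (2 ^ k) (2 ^ m) (h0k k) (h0k m) (g k) (γ m)
      (hgF k) (hγF m)
    refine hans (summable_of_sum_range_le (c := c₀⁻¹ * (B * ∫ x, ‖θ x‖)) ha fun m => ?_)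
    have hS : HasSum (fun k => (((((2 ^ m) ^ n)⁻¹ * (a k * r k m) : ℝ)) : ℂ))
        (∫ x, F x * (starRingEnd ℂ) (γ m x)) := by
      have hcs : HasCompactSupport (γ m) :=
        (isCompact_closedBall x₀ ρ).of_isClosed_subset (isClosed_tsupport _) (hγρ m)
      rw [← hFg _ hcs, hfW]
      convert hsum ((fun g => ∂_{e} g)^[q] (γ m)) using 1
      ext k
      rw [hterm, Complex.ofReal_mul (a k), mul_assoc, hr, finrank_euclideanSpace_fin]
      push_cast
      ring
    have hS' := Complex.hasSum_re hS
    simp only [Complex.ofReal_re] at hS'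
    have hle := (sum_le_hasSum (Finset.range m) (fun k _ => by
      have := ha k
      have := hr0 k m
      positivity) hS').trans ((Complex.re_le_norm _).trans (hupper m))
    rw [← Finset.mul_sum] at hle
    have hle' := le_of_mul_le_mul_left hle (by positivity)
    rw [← div_eq_inv_mul, le_div_iff₀ hc₀, Finset.sum_mul]
    refine (Finset.sum_le_sum fun k hk => ?_).trans hle'
    exact mul_le_mul_of_nonneg_left (hrc k m (pow_le_pow_right₀ (by norm_num)
      (Finset.mem_range.1 hk).le)) (ha k)
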